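/- arXiv:1212.4701 — 7 statements merged into one kernel-verified Lean document; each statement's English description precedes it below -/
import Mathlib

section
/- Clamped-inverse form of the stationarity conditions: fix λ ∈ ℝ^n and set for each i the number c_i = −∑_{k=i}^n λ_k. Then reals (y_i, η_i, δ_i) satisfy g_i(y_i) = c_i + η_i − δ_i, y_i·η_i = 0, y_i ≥ 0, η_i ≥ 0, (β_i − y_i)·δ_i = 0, y_i ≤ β_i, δ_i ≥ 0, if and only if y_i = H_i(c_i), η_i = (φ_i(c_i) − c_i)^+ and δ_i = (c_i − φ_i(c_i))^+, where x^+ = max{x, 0}. -/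
/-- Clamped-inverse form of the stationarity conditions.  For each `i`,
`g i` is the (continuous, strictly increasing) derivative of `f i` on `[0, β i]`,
`l i = g i 0`, `h i = g i (β i)`, `φ i x = max (l i) (min x (h i))` and
`H i x = (g i)⁻¹ (φ i x)`, characterized by `H i x ∈ [0, β i]` and `g i (H i x) = φ i x`. -/
theorem clamped_inverse_stationarity
    (n : ℕ) (hn : 1 ≤ n)
    (β : ℕ → ℝ) (hβ : ∀ i ∈ Finset.Icc 1 n, 0 < β i)
    (g : ℕ → ℝ → ℝ)
    (hgcont : ∀ i ∈ Finset.Icc 1 n, ContinuousOn (g i) (Set.Icc 0 (β i)))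
    (hgmono : ∀ i ∈ Finset.Icc 1 n, StrictMonoOn (g i) (Set.Icc 0 (β i)))
    (H : ℕ → ℝ → ℝ)
    (hH : ∀ i ∈ Finset.Icc 1 n, ∀ x : ℝ,
      H i x ∈ Set.Icc 0 (β i) ∧
      g i (H i x) = max (g i 0) (min x (g i (β i))))
    (lam : ℕ → ℝ) (c : ℕ → ℝ)
    (hc : ∀ i ∈ Finset.Icc 1 n, c i = -(∑ k ∈ Finset.Icc i n, lam k)) :
    ∀ i ∈ Finset.Icc 1 n, ∀ y η δ : ℝ,
      (g i y = c i + η - δ ∧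
       y * η = 0 ∧ 0 ≤ y ∧ 0 ≤ η ∧
       (β i - y) * δ = 0 ∧ y ≤ β i ∧ 0 ≤ δ)
      ↔
      (y = H i (c i) ∧
       η = max (max (g i 0) (min (c i) (g i (β i))) - c i) 0 ∧
       δ = max (c i - max (g i 0) (min (c i) (g i (β i)))) 0) := by
  intro i hi y η δ
  have hb := hβ i hi
  have hm := hgmono i hi
  obtain ⟨hHm, hHg⟩ := hH i hi (c i)
  have h0 : (0 : ℝ) ∈ Set.Icc 0 (β i) := ⟨le_refl _, hb.le⟩
  have h1 : β i ∈ Set.Icc 0 (β i) := ⟨hb.le, le_refl _⟩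
  have hlt : g i 0 < g i (β i) := hm h0 h1 hb
  generalize c i = C at *
  constructor
  · rintro ⟨hg, hyη, hy0, hη, hyδ, hyb, hδ⟩
    have hy : y ∈ Set.Icc 0 (β i) := ⟨hy0, hyb⟩
    have hgl : g i 0 ≤ g i y := hm.monotoneOn h0 hy hy0
    have hgu : g i y ≤ g i (β i) := hm.monotoneOn hy h1 hyb
    have key : g i y = max (g i 0) (min C (g i (β i))) ∧ (η = 0 ∨ δ = 0) := by
      rcases mul_eq_zero.1 hyη with h | h <;> rcases mul_eq_zero.1 hyδ with h' | h'
      · exfalso; linarith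
      · subst h
        refine ⟨?_, Or.inr h'⟩
        rw [max_eq_left]
        exact (min_le_left _ _).trans (by linarith)
      · have e : y = β i := by linarith
        subst e
        refine ⟨?_, Or.inl h⟩
        rw [min_eq_right (by linarith), max_eq_right hlt.le]
      · refine ⟨?_, Or.inl h⟩
        rw [min_eq_left (by linarith), max_eq_right (by linarith)]
        linarith
    obtain ⟨k1, k2⟩ := key
    refine ⟨hm.injOn hy hHm (k1.trans hHg.symm), ?_, ?_⟩
    · rw [← k1]
      rcases k2 with h | h
      · rw [max_eq_right (by linarith)]; exact h
      · rw [max_eq_left (by linarith)]; linarith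
    · rw [← k1]
      rcases k2 with h | h
      · rw [max_eq_left (by linarith)]; linarith
      · rw [max_eq_right (by linarith)]; exact h
  · rintro ⟨rfl, rfl, rfl⟩
    rw [← hHg]
    refine ⟨?_, ?_, hHm.1, le_max_right _ _, ?_, hHm.2, le_max_right _ _⟩
    · rcases le_total (g i (H i C)) C with h | h
      · rw [max_eq_right (by linarith), max_eq_left (by linarith)]; ring
      · rw [max_eq_left (by linarith), max_eq_right (by linarith)]; ring
    · rcases le_or_gt (g i 0) C with h | h
      · have : g i (H i C) ≤ C := by rw [hHg]; exact max_le h (min_le_left _ _)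
        rw [max_eq_right (by linarith), mul_zero]
      · have : g i (H i C) = g i 0 := by
          rw [hHg, max_eq_left ((min_le_left _ _).trans h.le)]
        rw [hm.injOn hHm h0 this, zero_mul]
    · rcases le_or_gt C (g i (β i)) with h | h
      · have : C ≤ g i (H i C) := by rw [hHg, min_eq_left h]; exact le_max_right _ _
        rw [max_eq_right (by linarith), mul_zero]
      · have : g i (H i C) = g i (β i) := by
          rw [hHg, min_eq_right h.le, max_eq_right hlt.le]
        rw [hm.injOn hHm h1 this, sub_self, zero_mul]
end

section
/- Every optimal solution of (P3) is bounded above by the unconstrained block minimizers: if y* is an optimal solution of (P3), then y*_i ≤ ȳ_i for every i = 1,...,n, where ȳ_i is the unique minimizer of f_i over [0, β_i]. -/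
/-- Every optimal solution of (P3) is bounded above componentwise by the
unconstrained block minimizers `ȳ_i` of `f i` over `[0, β i]`. -/
theorem optimal_le_block_minimizers
    (n : ℕ) (hn : 1 ≤ n)
    (α β : ℕ → ℝ)
    (hα : ∀ i ∈ Finset.Icc 1 n, 0 ≤ α i)
    (hβ : ∀ i ∈ Finset.Icc 1 n, 0 < β i)
    (f : ℕ → ℝ → ℝ)
    (hcont : ∀ i ∈ Finset.Icc 1 n, ContinuousOn (f i) (Set.Icc 0 (β i)))
    (hconv : ∀ i ∈ Finset.Icc 1 n, StrictConvexOn ℝ (Set.Icc 0 (β i)) (f i))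
    (ybar : ℕ → ℝ)
    (hybar : ∀ i ∈ Finset.Icc 1 n,
      ybar i ∈ Set.Icc 0 (β i) ∧ ∀ x ∈ Set.Icc 0 (β i), f i (ybar i) ≤ f i x)
    (ystar : ℕ → ℝ)
    -- y* is feasible for (P3)
    (hfeas : ∀ k ∈ Finset.Icc 1 n,
      ∑ i ∈ Finset.Icc 1 k, ystar i ≤ ∑ i ∈ Finset.Icc 1 k, α i)
    (hbox : ∀ i ∈ Finset.Icc 1 n, 0 ≤ ystar i ∧ ystar i ≤ β i)
    -- y* is optimal for (P3)
    (hopt : ∀ x : ℕ → ℝ,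
      (∀ k ∈ Finset.Icc 1 n, ∑ i ∈ Finset.Icc 1 k, x i ≤ ∑ i ∈ Finset.Icc 1 k, α i) →
      (∀ i ∈ Finset.Icc 1 n, 0 ≤ x i ∧ x i ≤ β i) →
      ∑ i ∈ Finset.Icc 1 n, f i (ystar i) ≤ ∑ i ∈ Finset.Icc 1 n, f i (x i)) :
    ∀ i ∈ Finset.Icc 1 n, ystar i ≤ ybar i := by
  intro i hi
  by_contra! hlt
  obtain ⟨hmem, hmin⟩ := hybar i hi
  have hle : ∀ j, Function.update ystar i (ybar i) j ≤ ystar j := by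
    intro j
    by_cases hj : j = i
    · subst hj; simpa using hlt.le
    · simp [Function.update_of_ne hj]
  have h := hopt (Function.update ystar i (ybar i))
    (fun k hk => (Finset.sum_le_sum fun j _ => hle j).trans (hfeas k hk))
    (by
      intro j hj
      by_cases hji : j = i
      · subst hji; simpa using hmem
      · simpa [Function.update_of_ne hji] using hbox j hj)
  have hfi : f i (ystar i) ≤ f i (ybar i) := by
    rw [← Finset.add_sum_erase _ _ hi,
      ← Finset.add_sum_erase _ (fun j => f j (Function.update ystar i (ybar i) j)) hi] at h
    have hs : ∑ j ∈ (Finset.Icc 1 n).erase i, f j (Function.update ystar i (ybar i) j)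
        = ∑ j ∈ (Finset.Icc 1 n).erase i, f j (ystar j) := by
      refine Finset.sum_congr rfl fun j hj => ?_
      rw [Function.update_of_ne (Finset.ne_of_mem_erase hj)]
    rw [hs] at h
    simpa using h
  have heq : ystar i = ybar i :=
    (hconv i hi).eq_of_isMinOn (fun x hx => hfi.trans (hmin x hx)) (fun x hx => hmin x hx)
      (hbox i hi) hmem
  exact hlt.ne' heq
end

section
/- Slackness of constraints outside the set S: suppose indices j < k in {1,...,n} satisfy ∑_{i=j+1}^{k} (ȳ_i − α_i) < 0, where ȳ_i is the unique minimizer of f_i over [0, β_i]. Then every optimal solution y* of (P3) satisfies ∑_{i=1}^{k} y*_i < ∑_{i=1}^{k} α_i; consequently, any multiplier λ*_k ≥ 0 satisfying the complementarity condition λ*_k·(∑_{i=1}^k y*_i − ∑_{i=1}^k α_i) = 0 must equal 0. -/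
/-- Slackness of constraints outside the set `S`: if `j < k` and
`∑_{i=j+1}^k (ȳ_i - α_i) < 0`, then every optimal solution `y*` of (P3) satisfies
`∑_{i=1}^k y*_i < ∑_{i=1}^k α_i`; consequently any multiplier `λ*_k ≥ 0`
satisfying the complementarity condition must vanish. -/
theorem slackness_outside_S
    (n : ℕ) (hn : 1 ≤ n)
    (α β : ℕ → ℝ)
    (hα : ∀ i ∈ Finset.Icc 1 n, 0 ≤ α i)
    (hβ : ∀ i ∈ Finset.Icc 1 n, 0 < β i)
    (f : ℕ → ℝ → ℝ)
    (hcont : ∀ i ∈ Finset.Icc 1 n, ContinuousOn (f i) (Set.Icc 0 (β i)))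
    (hconv : ∀ i ∈ Finset.Icc 1 n, StrictConvexOn ℝ (Set.Icc 0 (β i)) (f i))
    (ybar : ℕ → ℝ)
    (hybar : ∀ i ∈ Finset.Icc 1 n,
      ybar i ∈ Set.Icc 0 (β i) ∧ ∀ x ∈ Set.Icc 0 (β i), f i (ybar i) ≤ f i x)
    (j k : ℕ) (hj : j < k) (hjmem : j ∈ Finset.Icc 1 n) (hk : k ∈ Finset.Icc 1 n)
    (hslack : ∑ i ∈ Finset.Icc (j + 1) k, (ybar i - α i) < 0)
    (ystar : ℕ → ℝ)
    -- y* is feasible for (P3)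
    (hfeas : ∀ m ∈ Finset.Icc 1 n,
      ∑ i ∈ Finset.Icc 1 m, ystar i ≤ ∑ i ∈ Finset.Icc 1 m, α i)
    (hbox : ∀ i ∈ Finset.Icc 1 n, 0 ≤ ystar i ∧ ystar i ≤ β i)
    -- y* is optimal for (P3)
    (hopt : ∀ x : ℕ → ℝ,
      (∀ m ∈ Finset.Icc 1 n, ∑ i ∈ Finset.Icc 1 m, x i ≤ ∑ i ∈ Finset.Icc 1 m, α i) →
      (∀ i ∈ Finset.Icc 1 n, 0 ≤ x i ∧ x i ≤ β i) →
      ∑ i ∈ Finset.Icc 1 n, f i (ystar i) ≤ ∑ i ∈ Finset.Icc 1 n, f i (x i)) :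
    (∑ i ∈ Finset.Icc 1 k, ystar i < ∑ i ∈ Finset.Icc 1 k, α i) ∧
    (∀ lamk : ℝ, 0 ≤ lamk →
      lamk * (∑ i ∈ Finset.Icc 1 k, ystar i - ∑ i ∈ Finset.Icc 1 k, α i) = 0 →
      lamk = 0) := by
  have hle : ∀ i ∈ Finset.Icc 1 n, ystar i ≤ ybar i := by
    intro i hi
    by_contra hlt
    rw [not_le] at hlt
    have hb := hybar i hi
    have hlt' : f i (ybar i) < f i (ystar i) := by
      refine lt_of_le_of_ne (hb.2 _ (hbox i hi)) ?_
      intro heq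
      have hmin1 : IsMinOn (f i) (Set.Icc 0 (β i)) (ybar i) := fun x hx => hb.2 x hx
      have hmin2 : IsMinOn (f i) (Set.Icc 0 (β i)) (ystar i) := fun x hx => by
        have := hb.2 x hx
        simp only [Set.mem_setOf_eq]
        linarith
      exact hlt.ne ((hconv i hi).eq_of_isMinOn hmin1 hmin2 hb.1 (hbox i hi))
    have hxle : ∀ m, Function.update ystar i (ybar i) m ≤ ystar m := by
      intro m
      by_cases h : m = i
      · subst h; simpa using hlt.le
      · simp [h]
    have h := hopt (Function.update ystar i (ybar i))
      (fun m hm => (Finset.sum_le_sum fun l _ => hxle l).trans (hfeas m hm))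
      (fun m hm => by
        by_cases h : m = i
        · subst h; simpa using hb.1
        · simpa [h] using hbox m hm)
    refine absurd h (not_le.mpr ?_)
    refine Finset.sum_lt_sum (fun m _ => ?_) ⟨i, hi, by simpa using hlt'⟩
    by_cases h : m = i
    · subst h; simpa using hlt'.le
    · simp [h]
  have hsplit : ∀ g : ℕ → ℝ, ∑ i ∈ Finset.Icc 1 k, g i
      = ∑ i ∈ Finset.Icc 1 j, g i + ∑ i ∈ Finset.Icc (j + 1) k, g i := by
    intro g
    rw [← Finset.sum_union]
    · congr 1
      ext x
      simp only [Finset.mem_union, Finset.mem_Icc] at *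
      omega
    · rw [Finset.disjoint_left]
      intro x hx hx'
      simp only [Finset.mem_Icc] at *
      omega
  have hmain : ∑ i ∈ Finset.Icc 1 k, ystar i < ∑ i ∈ Finset.Icc 1 k, α i := by
    rw [hsplit, hsplit]
    have h1 := hfeas j hjmem
    have h2 : ∑ i ∈ Finset.Icc (j + 1) k, ystar i ≤ ∑ i ∈ Finset.Icc (j + 1) k, ybar i := by
      refine Finset.sum_le_sum fun i hi => hle i ?_
      simp only [Finset.mem_Icc] at *
      omega
    rw [Finset.sum_sub_distrib] at hslack
    linarith
  refine ⟨hmain, fun lamk _ h => ?_⟩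
  rcases mul_eq_zero.mp h with h | h
  · exact h
  · linarith
end

section
/- Differentiability of the newsvendor objective: let D be a nonnegative integrable real random variable whose cumulative distribution function F_D is continuous on ℝ, and let u, o ≥ 0. Then the function f(y) = u·E[(D − y)^+] + o·E[(y − D)^+] is differentiable at every y > 0 with derivative f'(y) = (u + o)·F_D(y) − u. -/
open MeasureTheory

/-- Differentiability of the newsvendor objective: if `D` is a nonnegative
integrable random variable whose CDF `F` is continuous on `ℝ`, and `u, o ≥ 0`,
then `f(y) = u·E[(D - y)⁺] + o·E[(y - D)⁺]` is differentiable at every `y > 0`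
with derivative `(u + o)·F(y) - u`. -/
theorem newsvendor_derivative
    {Ω : Type*} [MeasurableSpace Ω] (μ : Measure Ω) [IsProbabilityMeasure μ]
    (D : Ω → ℝ) (hD : Measurable D)
    (hDnonneg : ∀ ω, 0 ≤ D ω)
    (hDint : Integrable D μ)
    (F : ℝ → ℝ) (hF : ∀ t, F t = (μ {ω | D ω ≤ t}).toReal)
    (hFcont : Continuous F)
    (u o : ℝ) (hu : 0 ≤ u) (ho : 0 ≤ o)
    (y : ℝ) (hy : 0 < y) :
    HasDerivAt
      (fun y => u * (∫ ω, max (D ω - y) 0 ∂μ) + o * (∫ ω, max (y - D ω) 0 ∂μ))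
      ((u + o) * F y - u) y := by
  have hle : ∀ t, MeasurableSet {ω | D ω ≤ t} := fun t => measurableSet_le hD measurable_const
  have hmeq : MeasurableSet {ω | D ω = y} := measurableSet_eq_fun hD measurable_const
  have hF' : ∀ t, F t = μ.real {ω | D ω ≤ t} := hF
  -- no atom at `y`
  have hkey : ∀ x, x < y → F x ≤ F y - μ.real {ω | D ω = y} := by
    intro x hx
    have hdis : Disjoint {ω | D ω ≤ x} {ω | D ω = y} := by
      rw [Set.disjoint_left]
      intro ω h1 h2
      simp only [Set.mem_ofPred_eq] at h1 h2
      linarith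
    have h1 := measureReal_union (μ := μ) hdis hmeq
    have h2 : μ.real ({ω | D ω ≤ x} ∪ {ω | D ω = y}) ≤ μ.real {ω | D ω ≤ y} := by
      refine measureReal_mono ?_ (measure_ne_top μ _)
      rintro ω (h | h)
      · exact le_trans h hx.le
      · exact le_of_eq h
    rw [hF' x, hF' y]
    linarith
  have hlim : F y ≤ F y - μ.real {ω | D ω = y} := by
    have ht : Filter.Tendsto F (nhdsWithin y (Set.Iio y)) (nhds (F y)) :=
      hFcont.continuousAt.mono_left nhdsWithin_le_nhds
    refine le_of_tendsto ht ?_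
    filter_upwards [self_mem_nhdsWithin] with x hx using hkey x hx
  have hzero : μ {ω | D ω = y} = 0 := by
    have h0 : μ.real {ω | D ω = y} = 0 := le_antisymm (by linarith) measureReal_nonneg
    exact (measureReal_eq_zero_iff).1 h0
  have hne : ∀ᵐ ω ∂μ, D ω ≠ y := by
    rw [ae_iff]
    simpa using hzero
  have hint : ∀ x : ℝ, Integrable (fun ω => max (x - D ω) 0) μ := fun x =>
    ((integrable_const x).sub hDint).pos_part
  have hG : HasDerivAt (fun x => ∫ ω, max (x - D ω) 0 ∂μ) (F y) y := by
    have h := (hasDerivAt_integral_of_dominated_loc_of_lip (μ := μ) (𝕜 := ℝ)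
      (F := fun x ω => max (x - D ω) 0) (x₀ := y) (s := Set.univ)
      (F' := Set.indicator {ω | D ω ≤ y} (fun _ => (1 : ℝ))) (bound := fun _ => (1 : ℝ))
      Filter.univ_mem (Filter.Eventually.of_forall fun x => (hint x).aestronglyMeasurable)
      (hint y) ((measurable_const.indicator (hle y)).aestronglyMeasurable)
      (Filter.Eventually.of_forall fun ω => ?_) (integrable_const 1) ?_).2
    · rw [integral_indicator (hle y)] at h
      simpa [hF' y] using h
    · apply LipschitzOnWith.of_dist_le_mul
      intro a _ b _
      simp only [Real.dist_eq, map_one, NNReal.coe_one, one_mul]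
      have h := abs_max_sub_max_le_abs (a - D ω) (b - D ω) 0
      simpa using h
    · filter_upwards [hne] with ω hω
      rcases lt_or_gt_of_ne hω with h | h
      · have e : Set.indicator {ω | D ω ≤ y} (fun _ => (1 : ℝ)) ω = 1 :=
          Set.indicator_of_mem (s := {ω | D ω ≤ y}) h.le _
        rw [e]
        refine ((hasDerivAt_id y).sub_const (D ω)).congr_of_eventuallyEq ?_
        filter_upwards [lt_mem_nhds h] with x hx
        simp [hx.le]
      · have e : Set.indicator {ω | D ω ≤ y} (fun _ => (1 : ℝ)) ω = 0 :=
          Set.indicator_of_notMem (s := {ω | D ω ≤ y}) (not_le.2 h) _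
        rw [e]
        refine (hasDerivAt_const y (0 : ℝ)).congr_of_eventuallyEq ?_
        filter_upwards [gt_mem_nhds h] with x hx
        simp [hx.le]
  have hH : ∀ x : ℝ, ∫ ω, max (D ω - x) 0 ∂μ
      = (∫ ω, max (x - D ω) 0 ∂μ) + (∫ ω, D ω ∂μ) - x := by
    intro x
    have e : (fun ω => max (D ω - x) 0) = fun ω => (max (x - D ω) 0 + D ω) - x := by
      funext ω
      rcases le_total (D ω) x with h | h
      · rw [max_eq_right (by linarith), max_eq_left (by linarith)]; ring
      · rw [max_eq_left (by linarith), max_eq_right (by linarith)]; ring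
    have hs : Integrable (fun ω => max (x - D ω) 0 + D ω) μ := (hint x).add hDint
    rw [e, integral_sub hs (integrable_const x), integral_add (hint x) hDint]
    simp
  simp only [hH]
  have h := (((hG.add_const (∫ ω, D ω ∂μ)).sub (hasDerivAt_id y)).const_mul u).add
    (hG.const_mul o)
  refine h.congr_deriv ?_
  ring
end

section
/- (Lemma 1 of the paper, algorithm-free form) Let 0 = w_0 < w_1 < ... < w_L ≤ n be indices, fix j̄ ∈ {1, ..., L−1}, and let λ ∈ ℝ^n be a vector with λ_k = 0 for every k ∉ {w_{j̄+1}, ..., w_L} and λ_{w_t} ≥ 0 for t = j̄+1, ..., L. Define ỹ_s = H_s(−∑_{k=s}^n λ_k) for each s. Assume: (a) ∑_{s=w_{j̄}+1}^{k} (ỹ_s − α_s) ≤ 0 for every k with w_{j̄}+1 ≤ k ≤ n; (b) λ_k·∑_{s=w_{j̄}+1}^{k} (ỹ_s − α_s) = 0 for every k with w_{j̄}+1 ≤ k ≤ n; (c) ∑_{s=w_{j̄−1}+1}^{w_{j̄}} ( H_s(−∑_{t=j̄+1}^{L} λ_{w_t}) − α_s ) < 0; (d) the index r* = min{ r : j̄+1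 ≤ r ≤ L and ∑_{s=w_{j̄−1}+1}^{w_r} ( H_s(−∑_{t=r+1}^{L} λ_{w_t}) − α_s ) ≥ 0 } exists. Then λ_{w_{r*}} > 0. -/
/-- Lemma 1 of the paper, algorithm-free form.  `H s` is the clamped inverse of
the continuous strictly increasing derivative `g s` on `[0, β s]`.  Given indices
`0 = w_0 < w_1 < … < w_L ≤ n`, a level `j̄`, nonnegative multipliers supported on
`{w_{j̄+1}, …, w_L}`, the partial KKT conditions (a)–(b) at level `j̄+1`, the
Case-2 condition (c), and the minimal index `r*` of (d), one has `λ_{w_{r*}} > 0`. -/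
theorem lemma1_lam_wrstar_pos
    (n : ℕ) (hn : 1 ≤ n)
    (α β : ℕ → ℝ)
    (hα : ∀ i ∈ Finset.Icc 1 n, 0 ≤ α i)
    (hβ : ∀ i ∈ Finset.Icc 1 n, 0 < β i)
    (g : ℕ → ℝ → ℝ)
    (hgcont : ∀ i ∈ Finset.Icc 1 n, ContinuousOn (g i) (Set.Icc 0 (β i)))
    (hgmono : ∀ i ∈ Finset.Icc 1 n, StrictMonoOn (g i) (Set.Icc 0 (β i)))
    (H : ℕ → ℝ → ℝ)
    (hH : ∀ i ∈ Finset.Icc 1 n, ∀ x : ℝ,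
      H i x ∈ Set.Icc 0 (β i) ∧
      g i (H i x) = max (g i 0) (min x (g i (β i))))
    -- the indices 0 = w_0 < w_1 < … < w_L ≤ n
    (L : ℕ) (w : ℕ → ℕ)
    (hw0 : w 0 = 0)
    (hwmono : ∀ j < L, w j < w (j + 1))
    (hwL : w L ≤ n)
    -- the level j̄ ∈ {1, …, L-1}
    (jbar : ℕ) (hjbar : jbar ∈ Finset.Icc 1 (L - 1)) (hL2 : 2 ≤ L)
    -- the multipliers λ, supported on {w_{j̄+1}, …, w_L} and nonnegative there
    (lam : ℕ → ℝ)
    (hlam_supp : ∀ k : ℕ, (∀ t ∈ Finset.Icc (jbar + 1) L, k ≠ w t) → lam k = 0)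
    (hlam_nonneg : ∀ t ∈ Finset.Icc (jbar + 1) L, 0 ≤ lam (w t))
    -- ỹ_s = H_s(-∑_{k=s}^n λ_k)
    (ytil : ℕ → ℝ)
    (hytil : ∀ s ∈ Finset.Icc 1 n, ytil s = H s (-(∑ k ∈ Finset.Icc s n, lam k)))
    -- (a) partial primal feasibility at level j̄+1
    (ha : ∀ k ∈ Finset.Icc (w jbar + 1) n,
      ∑ s ∈ Finset.Icc (w jbar + 1) k, (ytil s - α s) ≤ 0)
    -- (b) partial complementarity at level j̄+1
    (hb : ∀ k ∈ Finset.Icc (w jbar + 1) n,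
      lam k * ∑ s ∈ Finset.Icc (w jbar + 1) k, (ytil s - α s) = 0)
    -- (c) the Case-2 condition
    (hc : ∑ s ∈ Finset.Icc (w (jbar - 1) + 1) (w jbar),
      (H s (-(∑ t ∈ Finset.Icc (jbar + 1) L, lam (w t))) - α s) < 0)
    -- (d) r* is the least index in {j̄+1, …, L} with a nonnegative partial sum
    (rstar : ℕ) (hrstar : rstar ∈ Finset.Icc (jbar + 1) L)
    (hrstar_ge : 0 ≤ ∑ s ∈ Finset.Icc (w (jbar - 1) + 1) (w rstar),
      (H s (-(∑ t ∈ Finset.Icc (rstar + 1) L, lam (w t))) - α s))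
    (hrstar_min : ∀ r ∈ Finset.Icc (jbar + 1) L, r < rstar →
      ∑ s ∈ Finset.Icc (w (jbar - 1) + 1) (w r),
        (H s (-(∑ t ∈ Finset.Icc (r + 1) L, lam (w t))) - α s) < 0) :
    0 < lam (w rstar) := by
  have hlt : ∀ b, b ≤ L → ∀ a, a < b → w a < w b := by
    intro b
    induction b with
    | zero => intro _ a ha'; omega
    | succ b ih =>
      intro hb' a hab
      have h1 := hwmono b (by omega)
      rcases Nat.lt_or_ge a b with h | h
      · exact (ih (by omega) a h).trans h1
      · have : a = b := by omega
        subst this; exact h1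
  have hle : ∀ a b, a ≤ b → b ≤ L → w a ≤ w b := by
    intro a b hab hb'
    rcases hab.lt_or_eq with h | h
    · exact (hlt b hb' a h).le
    · subst h; exact le_rfl
  have hsplit : ∀ (f : ℕ → ℝ) (a b c : ℕ), a ≤ b → b ≤ c →
      ∑ s ∈ Finset.Icc (a + 1) c, f s =
        ∑ s ∈ Finset.Icc (a + 1) b, f s + ∑ s ∈ Finset.Icc (b + 1) c, f s := by
    intro f a b c hab hbc
    have e : ∀ x y : ℕ, Finset.Icc (x + 1) y = Finset.Ioc x y := by
      intro x y; ext z; simp [Nat.succ_le_iff]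
    rw [e, e, e, Finset.sum_Ioc_consecutive f hab hbc]
  rw [Finset.mem_Icc] at hjbar hrstar
  by_contra hneg
  have hex : ∀ r, jbar ≤ r → r ≤ L → ∃ q, jbar ≤ q ∧ q ≤ r ∧
      (q = jbar ∨ 0 < lam (w q)) ∧ ∀ t, q < t → t ≤ r → lam (w t) = 0 := by
    intro r hr
    induction r, hr using Nat.le_induction with
    | base => intro _; exact ⟨jbar, le_rfl, le_rfl, Or.inl rfl, fun t h1 h2 => by omega⟩
    | succ r hr ih =>
      intro hrL
      by_cases hp : 0 < lam (w (r + 1))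
      · exact ⟨r + 1, by omega, le_rfl, Or.inr hp, fun t h1 h2 => by omega⟩
      · obtain ⟨q, h1, h2, h3, h4⟩ := ih (by omega)
        refine ⟨q, h1, by omega, h3, fun t ht1 ht2 => ?_⟩
        rcases Nat.lt_or_ge r t with h | h
        · have : t = r + 1 := by omega
          subst this
          exact le_antisymm (not_lt.mp hp) (hlam_nonneg _ (Finset.mem_Icc.mpr ⟨by omega, hrL⟩))
        · exact h4 t ht1 h
  obtain ⟨q, hq1, hq2, hq3, hq4⟩ := hex rstar (by omega) hrstar.2
  have hqr : q < rstar := by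
    rcases hq2.lt_or_eq with h | h
    · exact h
    · subst h
      rcases hq3 with h | h
      · omega
      · exact absurd h hneg
  have hLam : ∑ t ∈ Finset.Icc (q + 1) L, lam (w t)
      = ∑ t ∈ Finset.Icc (rstar + 1) L, lam (w t) := by
    rw [hsplit (fun t => lam (w t)) q rstar L hq2 hrstar.2]
    rw [Finset.sum_eq_zero, zero_add]
    intro t ht
    rw [Finset.mem_Icc] at ht
    exact hq4 t (by omega) ht.2
  have hwr : w rstar ≤ n := (hle _ _ hrstar.2 le_rfl).trans hwL
  have hsum : ∀ s, w q < s → s ≤ w rstar →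
      ∑ k ∈ Finset.Icc s n, lam k = ∑ t ∈ Finset.Icc (rstar + 1) L, lam (w t) := by
    intro s hs1 hs2
    have hinj : Set.InjOn w (Finset.Icc (rstar + 1) L : Finset ℕ) := by
      intro a ha' b hb' hab
      rw [Finset.mem_coe, Finset.mem_Icc] at ha' hb'
      rcases lt_trichotomy a b with h | h | h
      · have := hlt b hb'.2 a h; omega
      · exact h
      · have := hlt a ha'.2 b h; omega
    rw [← Finset.sum_image (f := lam) hinj]
    symm
    apply Finset.sum_subset
    · intro k hk
      obtain ⟨t, ht, rfl⟩ := Finset.mem_image.mp hk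
      rw [Finset.mem_Icc] at ht
      rw [Finset.mem_Icc]
      exact ⟨hs2.trans (hle _ _ (by omega) ht.2), (hle _ _ ht.2 le_rfl).trans hwL⟩
    · intro k hk hk'
      rw [Finset.mem_Icc] at hk
      by_cases hx : ∃ t ∈ Finset.Icc (jbar + 1) L, k = w t
      · obtain ⟨t, ht, rfl⟩ := hx
        rw [Finset.mem_Icc] at ht
        rcases Nat.lt_or_ge q t with h | h
        · rcases Nat.lt_or_ge rstar t with h' | h'
          · exact absurd (Finset.mem_image_of_mem w (Finset.mem_Icc.mpr ⟨h', ht.2⟩)) hk'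
          · exact hq4 t h h'
        · have := hle t q h (by omega)
          omega
      · push Not at hx
        exact hlam_supp k hx
  have hwq : w jbar ≤ w q := hle _ _ hq1 (by omega)
  have hwqr : w q < w rstar := hlt _ hrstar.2 _ hqr
  -- first block
  have hfirst : ∑ s ∈ Finset.Icc (w (jbar - 1) + 1) (w q),
      (H s (-(∑ t ∈ Finset.Icc (rstar + 1) L, lam (w t))) - α s) < 0 := by
    rw [← hLam]
    rcases hq1.lt_or_eq with h | h
    · exact hrstar_min q (Finset.mem_Icc.mpr ⟨h, by omega⟩) hqr
    · subst h; exact hc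
  have hFq : ∑ s ∈ Finset.Icc (w jbar + 1) (w q), (ytil s - α s) = 0 := by
    rcases hq1.lt_or_eq with h | h
    · have hpos : 0 < lam (w q) := hq3.resolve_left (by omega)
      have h1 := hlt q (by omega) jbar h
      have := hb (w q) (Finset.mem_Icc.mpr ⟨h1, by omega⟩)
      exact (mul_eq_zero.mp this).resolve_left hpos.ne'
    · subst h; simp
  have hFr := ha (w rstar) (Finset.mem_Icc.mpr ⟨by omega, hwr⟩)
  rw [hsplit _ _ _ _ hwq hwqr.le, hFq, zero_add] at hFr
  have hsecond : ∑ s ∈ Finset.Icc (w q + 1) (w rstar),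
      (H s (-(∑ t ∈ Finset.Icc (rstar + 1) L, lam (w t))) - α s)
      = ∑ s ∈ Finset.Icc (w q + 1) (w rstar), (ytil s - α s) := by
    apply Finset.sum_congr rfl
    intro s hs
    rw [Finset.mem_Icc] at hs
    rw [hytil s (Finset.mem_Icc.mpr ⟨by omega, by omega⟩), hsum s (by omega) hs.2]
  rw [hsplit _ _ (w q) _ (hle _ _ (by omega) (by omega)) hwqr.le, hsecond] at hrstar_ge
  linarith
end

section
/- Base case of Proposition 1 (the first outer loop of Algorithm 1 preserves the partial KKT conditions): let ȳ_i = H_i(0) and d_k = ∑_{i=1}^k (ȳ_i − α_i); define w_1 = min{k : d_k ≥ 0} (assumed to exist), w_{j+1} = min{k > w_j : d_k ≥ d_{w_j}}, and let L be the largest j with w_j defined (set w_0 = 0). Suppose ξ ≥ 0 satisfies ∑_{s=w_{L−1}+1}^{w_L} (H_s(−ξ) − α_s) = 0. Define λ ∈ ℝ^n by λ_{w_L} = ξ and λ_k = 0 for k ≠ w_L, and y_i = H_i(−∑_{k=i}^n λ_k) for each i. Then (i) ∑_{s=w_{L−1}+1}^{k} (y_s − α_s) ≤ 0 for every k with w_{L−1}+1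 ≤ k ≤ n, and (ii) λ_k·∑_{s=w_{L−1}+1}^{k} (y_s − α_s) = 0 for every k with w_{L−1}+1 ≤ k ≤ n. -/
/-- Base case of Proposition 1: the first outer loop of Algorithm 1 (Case 1 at
`j = L`) produces multipliers satisfying the partial KKT conditions at level `L`.
Here `H i` is the clamped inverse of the continuous strictly increasing
derivative `g i` on `[0, β i]`, `ȳ_i = H_i(0)`, `d_k = ∑_{i=1}^k (ȳ_i - α_i)`,
and the indices `w_j` are defined by `w_1 = min{k : d_k ≥ 0}`,
`w_{j+1} = min{k > w_j : d_k ≥ d_{w_j}}`, with `L` the largest defined index. -/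
theorem prop1_base_case
    (n : ℕ) (hn : 1 ≤ n)
    (α β : ℕ → ℝ)
    (hα : ∀ i ∈ Finset.Icc 1 n, 0 ≤ α i)
    (hβ : ∀ i ∈ Finset.Icc 1 n, 0 < β i)
    (g : ℕ → ℝ → ℝ)
    (hgcont : ∀ i ∈ Finset.Icc 1 n, ContinuousOn (g i) (Set.Icc 0 (β i)))
    (hgmono : ∀ i ∈ Finset.Icc 1 n, StrictMonoOn (g i) (Set.Icc 0 (β i)))
    (H : ℕ → ℝ → ℝ)
    (hH : ∀ i ∈ Finset.Icc 1 n, ∀ x : ℝ,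
      H i x ∈ Set.Icc 0 (β i) ∧
      g i (H i x) = max (g i 0) (min x (g i (β i))))
    -- d_k = ∑_{i=1}^k (ȳ_i - α_i) with ȳ_i = H_i(0)
    (d : ℕ → ℝ)
    (hd : ∀ k, d k = ∑ i ∈ Finset.Icc 1 k, (H i 0 - α i))
    -- the indices w_0 = 0 < w_1 < … < w_L ≤ n
    (L : ℕ) (hL : 1 ≤ L) (w : ℕ → ℕ)
    (hw0 : w 0 = 0)
    -- w_1 = min{k ∈ {1,…,n} : d_k ≥ 0}
    (hw1 : w 1 ∈ Finset.Icc 1 n ∧ 0 ≤ d (w 1) ∧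
      ∀ k ∈ Finset.Icc 1 n, k < w 1 → d k < 0)
    -- w_{j+1} = min{k ∈ {1,…,n} : k > w_j and d_k ≥ d_{w_j}}
    (hwsucc : ∀ j, 1 ≤ j → j < L →
      w (j + 1) ∈ Finset.Icc 1 n ∧ w j < w (j + 1) ∧ d (w j) ≤ d (w (j + 1)) ∧
      ∀ k ∈ Finset.Icc 1 n, w j < k → k < w (j + 1) → d k < d (w j))
    -- L is the largest index for which w is defined
    (hLmax : ∀ k ∈ Finset.Icc 1 n, w L < k → d k < d (w L))
    -- ξ solves the equation of the first loop
    (ξ : ℝ) (hξ : 0 ≤ ξ)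
    (hξeq : ∑ s ∈ Finset.Icc (w (L - 1) + 1) (w L), (H s (-ξ) - α s) = 0)
    -- λ_{w_L} = ξ and λ_k = 0 otherwise
    (lam : ℕ → ℝ)
    (hlam : lam (w L) = ξ ∧ ∀ k : ℕ, k ≠ w L → lam k = 0)
    -- y_i = H_i(-∑_{k=i}^n λ_k)
    (y : ℕ → ℝ)
    (hy : ∀ i ∈ Finset.Icc 1 n, y i = H i (-(∑ k ∈ Finset.Icc i n, lam k))) :
    (∀ k ∈ Finset.Icc (w (L - 1) + 1) n,
      ∑ s ∈ Finset.Icc (w (L - 1) + 1) k, (y s - α s) ≤ 0) ∧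
    (∀ k ∈ Finset.Icc (w (L - 1) + 1) n,
      lam k * ∑ s ∈ Finset.Icc (w (L - 1) + 1) k, (y s - α s) = 0) := by
  obtain ⟨hl1, hl0⟩ := hlam
  -- basic facts on the two consecutive indices
  have key : w (L - 1) < w L ∧ w L ≤ n ∧
      ∀ k ∈ Finset.Icc 1 n, w (L - 1) < k → k < w L → d k < d (w (L - 1)) := by
    have hd0 : d 0 = 0 := by simp [hd]
    rcases Nat.lt_or_ge 1 L with h | h
    · obtain ⟨h1, h2, h3, h4⟩ := hwsucc (L - 1) (by omega) (by omega)
      rw [Nat.sub_add_cancel hL] at h1 h2 h3 h4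
      exact ⟨h2, (Finset.mem_Icc.1 h1).2, h4⟩
    · obtain rfl : L = 1 := by omega
      obtain ⟨h1, h2, h3⟩ := hw1
      have h1' := Finset.mem_Icc.1 h1
      simp only [Nat.sub_self, hw0, hd0]
      exact ⟨h1'.1, h1'.2, fun k hk _ hk2 => h3 k hk hk2⟩
  generalize w (L - 1) = a at *
  generalize w L = b at *
  obtain ⟨hab, hbn, hlow⟩ := key
  have hmono : ∀ i ∈ Finset.Icc 1 n, H i (-ξ) ≤ H i 0 := by
    intro i hi
    obtain ⟨m1, e1⟩ := hH i hi (-ξ)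
    obtain ⟨m2, e2⟩ := hH i hi 0
    rw [← (hgmono i hi).le_iff_le m1 m2, e1, e2]
    exact max_le_max le_rfl (min_le_min (by linarith) le_rfl)
  have hy1 : ∀ i, 1 ≤ i → i ≤ b → y i = H i (-ξ) := by
    intro i h1 h2
    rw [hy i (Finset.mem_Icc.2 ⟨h1, by omega⟩), Finset.sum_eq_single b, hl1]
    · intro k _ hk
      exact hl0 k hk
    · intro h
      exact absurd (Finset.mem_Icc.2 ⟨h2, hbn⟩) h
  have hy2 : ∀ i, b < i → i ≤ n → y i = H i 0 := by
    intro i h1 h2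
    rw [hy i (Finset.mem_Icc.2 ⟨by omega, h2⟩), Finset.sum_eq_zero, neg_zero]
    intro k hk
    have := (Finset.mem_Icc.1 hk).1
    exact hl0 k (by omega)
  have hIcc : ∀ p q : ℕ, Finset.Icc (p + 1) q = Finset.Ioc p q := by
    intro p q
    ext x
    simp only [Finset.mem_Icc, Finset.mem_Ioc]
    omega
  have hdd : ∀ p q : ℕ, p ≤ q → ∑ s ∈ Finset.Ioc p q, (H s 0 - α s) = d q - d p := by
    intro p q hpq
    have := Finset.sum_Ioc_consecutive (fun s => H s 0 - α s) (Nat.zero_le p) hpq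
    rw [hd, hd, ← Nat.zero_add 1, hIcc, hIcc]
    linarith
  rw [hIcc] at hξeq
  have hb : ∑ s ∈ Finset.Ioc a b, (y s - α s) = 0 := by
    rw [← hξeq]
    refine Finset.sum_congr rfl fun s hs => ?_
    have := Finset.mem_Ioc.1 hs
    rw [hy1 s (by omega) this.2]
  constructor
  · intro k hk
    have hk' := Finset.mem_Icc.1 hk
    have hk1 : k ∈ Finset.Icc 1 n := Finset.mem_Icc.2 ⟨by omega, hk'.2⟩
    rw [hIcc]
    rcases lt_trichotomy k b with h | h | h
    · have h1 : ∑ s ∈ Finset.Ioc a k, (y s - α s) ≤ ∑ s ∈ Finset.Ioc a k, (H s 0 - α s) := by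
        refine Finset.sum_le_sum fun s hs => ?_
        have hs' := Finset.mem_Ioc.1 hs
        rw [hy1 s (by omega) (by omega)]
        have := hmono s (Finset.mem_Icc.2 ⟨by omega, by omega⟩)
        linarith
      rw [hdd a k (by omega)] at h1
      have := hlow k hk1 (by omega) h
      linarith
    · rw [h, hb]
    · rw [← Finset.sum_Ioc_consecutive _ hab.le h.le, hb]
      have h1 : ∑ s ∈ Finset.Ioc b k, (y s - α s) = ∑ s ∈ Finset.Ioc b k, (H s 0 - α s) := by
        refine Finset.sum_congr rfl fun s hs => ?_
        have hs' := Finset.mem_Ioc.1 hs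
        rw [hy2 s hs'.1 (by omega)]
      rw [h1, hdd b k h.le]
      have := hLmax k hk1 h
      linarith
  · intro k _
    by_cases h : k = b
    · rw [h, hIcc, hb, mul_zero]
    · rw [hl0 k h, zero_mul]
end

section
/- Case-1 inductive step of Proposition 1: let ȳ_i = H_i(0), d_k = ∑_{i=1}^k (ȳ_i − α_i), and let 0 = w_0 < w_1 < ... < w_L ≤ n satisfy w_1 = min{k : d_k ≥ 0} and w_{j+1} = min{k > w_j : d_k ≥ d_{w_j}} for each j (so ∑_{s=w_j+1}^{k} (ȳ_s − α_s) < 0 whenever w_j < k < w_{j+1}). Fix j̄ ∈ {1, ..., L−1} and let λ ∈ ℝ^n with λ_k = 0 for k ∉ {w_{j̄+1}, ..., w_L} and λ_{w_t} ≥ 0 for t > j̄, and set ỹ_s = H_s(−∑_{k=s}^n λ_k). Assume the level-(j̄+1) conditions: ∑_{s=w_{j̄}+1}^{k} (ỹ_s − α_s) ≤ 0 and λ_k·∑_{s=w_{j̄}+1}^{k} (ỹ_s − α_s) = 0 for all k ≥ w_{j̄}+1. Suppose ∑_{s=w_{j̄−1}+1}^{w_{j̄}} ( H_s(−∑_{t=j̄+1}^L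 λ_{w_t}) − α_s ) ≥ 0 and that ξ ≥ 0 satisfies ∑_{s=w_{j̄−1}+1}^{w_{j̄}} ( H_s(−∑_{t=j̄+1}^L λ_{w_t} − ξ) − α_s ) = 0. Define λ' by λ'_{w_{j̄}} = ξ and λ'_k = λ_k otherwise, and y_i = H_i(−∑_{k=i}^n λ'_k). Then ∑_{s=w_{j̄−1}+1}^{k} (y_s − α_s) ≤ 0 for every k ≥ w_{j̄−1}+1, and λ'_k·∑_{s=w_{j̄−1}+1}^{k} (y_s − α_s) = 0 for every k ≥ w_{j̄−1}+1. -/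
/-- Case-1 inductive step of Proposition 1: if the partial KKT conditions hold
at level `j̄+1` and Case 1 of Algorithm 1 occurs at level `j̄` (with multiplier
`ξ` solving the loop equation), then the updated multipliers satisfy the
partial KKT conditions at level `j̄`.  Here `H i` is the clamped inverse of the
continuous strictly increasing derivative `g i` on `[0, β i]`, `ȳ_i = H_i(0)`,
`d_k = ∑_{i=1}^k (ȳ_i - α_i)`, and `0 = w_0 < w_1 < … < w_L ≤ n` with
`w_1 = min{k : d_k ≥ 0}` and `w_{j+1} = min{k > w_j : d_k ≥ d_{w_j}}`. -/
theorem prop1_case1_step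
    (n : ℕ) (hn : 1 ≤ n)
    (α β : ℕ → ℝ)
    (hα : ∀ i ∈ Finset.Icc 1 n, 0 ≤ α i)
    (hβ : ∀ i ∈ Finset.Icc 1 n, 0 < β i)
    (g : ℕ → ℝ → ℝ)
    (hgcont : ∀ i ∈ Finset.Icc 1 n, ContinuousOn (g i) (Set.Icc 0 (β i)))
    (hgmono : ∀ i ∈ Finset.Icc 1 n, StrictMonoOn (g i) (Set.Icc 0 (β i)))
    (H : ℕ → ℝ → ℝ)
    (hH : ∀ i ∈ Finset.Icc 1 n, ∀ x : ℝ,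
      H i x ∈ Set.Icc 0 (β i) ∧
      g i (H i x) = max (g i 0) (min x (g i (β i))))
    -- d_k = ∑_{i=1}^k (ȳ_i - α_i) with ȳ_i = H_i(0)
    (d : ℕ → ℝ)
    (hd : ∀ k, d k = ∑ i ∈ Finset.Icc 1 k, (H i 0 - α i))
    -- the indices 0 = w_0 < w_1 < … < w_L ≤ n
    (L : ℕ) (w : ℕ → ℕ)
    (hw0 : w 0 = 0)
    (hw1 : w 1 ∈ Finset.Icc 1 n ∧ 0 ≤ d (w 1) ∧
      ∀ k ∈ Finset.Icc 1 n, k < w 1 → d k < 0)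
    (hwsucc : ∀ j, 1 ≤ j → j < L →
      w (j + 1) ∈ Finset.Icc 1 n ∧ w j < w (j + 1) ∧ d (w j) ≤ d (w (j + 1)) ∧
      ∀ k ∈ Finset.Icc 1 n, w j < k → k < w (j + 1) → d k < d (w j))
    -- the level j̄ ∈ {1, …, L-1}
    (jbar : ℕ) (hjbar : jbar ∈ Finset.Icc 1 (L - 1)) (hL2 : 2 ≤ L)
    -- multipliers λ supported on {w_{j̄+1}, …, w_L}, nonnegative there
    (lam : ℕ → ℝ)
    (hlam_supp : ∀ k : ℕ, (∀ t ∈ Finset.Icc (jbar + 1) L, k ≠ w t) → lam k = 0)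
    (hlam_nonneg : ∀ t ∈ Finset.Icc (jbar + 1) L, 0 ≤ lam (w t))
    -- ỹ_s = H_s(-∑_{k=s}^n λ_k)
    (ytil : ℕ → ℝ)
    (hytil : ∀ s ∈ Finset.Icc 1 n, ytil s = H s (-(∑ k ∈ Finset.Icc s n, lam k)))
    -- the level-(j̄+1) partial KKT conditions
    (ha : ∀ k ∈ Finset.Icc (w jbar + 1) n,
      ∑ s ∈ Finset.Icc (w jbar + 1) k, (ytil s - α s) ≤ 0)
    (hb : ∀ k ∈ Finset.Icc (w jbar + 1) n,
      lam k * ∑ s ∈ Finset.Icc (w jbar + 1) k, (ytil s - α s) = 0)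
    -- Case 1 occurs at level j̄
    (hcase1 : 0 ≤ ∑ s ∈ Finset.Icc (w (jbar - 1) + 1) (w jbar),
      (H s (-(∑ t ∈ Finset.Icc (jbar + 1) L, lam (w t))) - α s))
    -- ξ solves the loop equation
    (ξ : ℝ) (hξ : 0 ≤ ξ)
    (hξeq : ∑ s ∈ Finset.Icc (w (jbar - 1) + 1) (w jbar),
      (H s (-(∑ t ∈ Finset.Icc (jbar + 1) L, lam (w t)) - ξ) - α s) = 0)
    -- the updated multipliers λ' and primal variables y
    (lam' : ℕ → ℝ)
    (hlam' : lam' (w jbar) = ξ ∧ ∀ k : ℕ, k ≠ w jbar → lam' k = lam k)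
    (y : ℕ → ℝ)
    (hy : ∀ i ∈ Finset.Icc 1 n, y i = H i (-(∑ k ∈ Finset.Icc i n, lam' k))) :
    (∀ k ∈ Finset.Icc (w (jbar - 1) + 1) n,
      ∑ s ∈ Finset.Icc (w (jbar - 1) + 1) k, (y s - α s) ≤ 0) ∧
    (∀ k ∈ Finset.Icc (w (jbar - 1) + 1) n,
      lam' k * ∑ s ∈ Finset.Icc (w (jbar - 1) + 1) k, (y s - α s) = 0) := by
  obtain ⟨hj1, hjL⟩ := Finset.mem_Icc.mp hjbar
  have hjL' : jbar < L := by omega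
  -- w is strictly increasing up to L
  have hwstep : ∀ j, j < L → w j < w (j + 1) := by
    intro j hj
    rcases Nat.eq_zero_or_pos j with h | h
    · subst h
      have := (Finset.mem_Icc.mp hw1.1).1
      rw [hw0]; exact this
    · exact (hwsucc j h hj).2.1
  have hwlt : ∀ u t, t < u → u ≤ L → w t < w u := by
    intro u
    induction u with
    | zero => intro t h; omega
    | succ m ih =>
      intro t h1 h2
      have h3 := hwstep m (by omega)
      rcases Nat.lt_succ_iff_lt_or_eq.mp h1 with h | h
      · exact (ih t h (by omega)).trans h3
      · subst h; exact h3
  have hwn : ∀ t, 1 ≤ t → t ≤ L → w t ≤ n := by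
    intro t h1 h2
    rcases Nat.eq_or_lt_of_le h1 with h | h
    · subst h; exact (Finset.mem_Icc.mp hw1.1).2
    · have := (hwsucc (t - 1) (by omega) (by omega)).1
      rw [Nat.sub_add_cancel h1] at this
      exact (Finset.mem_Icc.mp this).2
  have hab : w (jbar - 1) < w jbar := hwlt jbar (jbar - 1) (by omega) (by omega)
  have hbn : w jbar ≤ n := hwn jbar hj1 (by omega)
  -- d k < d a between
  have hdk : ∀ k, w (jbar - 1) < k → k < w jbar → d k < d (w (jbar - 1)) := by
    intro k h1 h2
    have hkm : k ∈ Finset.Icc 1 n := Finset.mem_Icc.mpr ⟨by omega, by omega⟩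
    rcases Nat.eq_or_lt_of_le hj1 with h | h
    · subst h
      have h0 : d 0 = 0 := by rw [hd]; simp
      have := hw1.2.2 k hkm h2
      simpa [hw0, h0] using this
    · have h4 := (hwsucc (jbar - 1) (by omega) (by omega)).2.2.2
      rw [Nat.sub_add_cancel hj1] at h4
      exact h4 k hkm h1 h2
  have hlam0 : ∀ k, k ≤ w jbar → lam k = 0 := by
    intro k hk
    apply hlam_supp
    intro t ht
    have := Finset.mem_Icc.mp ht
    have := hwlt t jbar (by omega) (by omega)
    omega
  set T := ∑ t ∈ Finset.Icc (jbar + 1) L, lam (w t) with hT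
  have hT0 : 0 ≤ T := Finset.sum_nonneg hlam_nonneg
  have hsumT : ∀ s, s ≤ w jbar → ∑ k ∈ Finset.Icc s n, lam k = T := by
    intro s hs
    have hinj : Set.InjOn w (Finset.Icc (jbar + 1) L : Finset ℕ) := by
      intro x hx z hz hxz
      have hx := Finset.mem_Icc.mp hx
      have hz := Finset.mem_Icc.mp hz
      rcases lt_trichotomy x z with h | h | h
      · have := hwlt z x h hz.2
        omega
      · exact h
      · have := hwlt x z h hx.2
        omega
    rw [hT, ← Finset.sum_image (f := lam) hinj]
    symm
    apply Finset.sum_subset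
    · intro k hk
      obtain ⟨t, ht, rfl⟩ := Finset.mem_image.mp hk
      have ht := Finset.mem_Icc.mp ht
      have h1 := hwlt t jbar (by omega) (by omega)
      exact Finset.mem_Icc.mpr ⟨by omega, hwn t (by omega) ht.2⟩
    · intro k _ hk
      apply hlam_supp
      intro t ht h
      exact hk (Finset.mem_image.mpr ⟨t, ht, h.symm⟩)
  have hlamAdd : ∀ k, lam' k = lam k + if k = w jbar then ξ else 0 := by
    intro k
    by_cases h : k = w jbar
    · subst h; rw [hlam'.1, hlam0 _ le_rfl]; simp
    · rw [hlam'.2 k h]; simp [h]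
  have hylow : ∀ s, 1 ≤ s → s ≤ w jbar → y s = H s (-T - ξ) := by
    intro s h1 h2
    rw [hy s (Finset.mem_Icc.mpr ⟨h1, by omega⟩)]
    congr 1
    have : ∑ k ∈ Finset.Icc s n, lam' k = T + ξ := by
      rw [Finset.sum_congr rfl (fun k _ => hlamAdd k), Finset.sum_add_distrib, hsumT s h2,
        Finset.sum_ite_eq', if_pos (Finset.mem_Icc.mpr ⟨h2, hbn⟩)]
    rw [this]; ring
  have hyhigh : ∀ s, w jbar < s → s ≤ n → y s = ytil s := by
    intro s h1 h2
    have hs : s ∈ Finset.Icc 1 n := Finset.mem_Icc.mpr ⟨by omega, h2⟩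
    rw [hy s hs, hytil s hs]
    congr 2
    apply Finset.sum_congr rfl
    intro k hk
    have := (Finset.mem_Icc.mp hk).1
    exact hlam'.2 k (by omega)
  have hmono : ∀ s ∈ Finset.Icc 1 n, H s (-T - ξ) ≤ H s 0 := by
    intro s hs
    rw [← (hgmono s hs).le_iff_le (hH s hs _).1 (hH s hs _).1, (hH s hs _).2, (hH s hs _).2]
    exact max_le_max le_rfl (min_le_min (by linarith) le_rfl)
  have hsplit : ∀ (F : ℕ → ℝ) (p q r : ℕ), p ≤ q → q ≤ r →
      ∑ s ∈ Finset.Icc (p + 1) r, F s =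
        ∑ s ∈ Finset.Icc (p + 1) q, F s + ∑ s ∈ Finset.Icc (q + 1) r, F s := by
    intro F p q r h1 h2
    rw [← Finset.sum_union]
    · congr 1
      ext x
      simp only [Finset.mem_union, Finset.mem_Icc]
      omega
    · rw [Finset.disjoint_left]
      intro x
      simp only [Finset.mem_Icc]
      omega
  -- sums below, at, and above b
  have hlow : ∀ k, w (jbar - 1) < k → k < w jbar →
      ∑ s ∈ Finset.Icc (w (jbar - 1) + 1) k, (y s - α s) ≤ 0 := by
    intro k h1 h2
    have h3 : ∑ s ∈ Finset.Icc (w (jbar - 1) + 1) k, (y s - α s) ≤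
        ∑ s ∈ Finset.Icc (w (jbar - 1) + 1) k, (H s 0 - α s) := by
      apply Finset.sum_le_sum
      intro s hs
      have hs := Finset.mem_Icc.mp hs
      rw [hylow s (by omega) (by omega)]
      have := hmono s (Finset.mem_Icc.mpr ⟨by omega, by omega⟩)
      linarith
    have h4 := hsplit (fun s => H s 0 - α s) 0 (w (jbar - 1)) k (Nat.zero_le _) h1.le
    have h5 := hdk k h1 h2
    rw [hd, hd] at h5
    simp only [zero_add] at h4
    linarith
  have hmid : ∑ s ∈ Finset.Icc (w (jbar - 1) + 1) (w jbar), (y s - α s) = 0 := by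
    rw [← hξeq]
    apply Finset.sum_congr rfl
    intro s hs
    have hs := Finset.mem_Icc.mp hs
    rw [hylow s (by omega) (by omega)]
  have hhigh : ∀ k, w jbar < k → k ≤ n →
      ∑ s ∈ Finset.Icc (w (jbar - 1) + 1) k, (y s - α s) =
        ∑ s ∈ Finset.Icc (w jbar + 1) k, (ytil s - α s) := by
    intro k h1 h2
    rw [hsplit _ _ _ _ hab.le h1.le, hmid, zero_add]
    apply Finset.sum_congr rfl
    intro s hs
    have hs := Finset.mem_Icc.mp hs
    rw [hyhigh s (by omega) (by omega)]
  constructor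
  · intro k hk
    have hk := Finset.mem_Icc.mp hk
    rcases lt_trichotomy k (w jbar) with h | h | h
    · exact hlow k (by omega) h
    · rw [h, hmid]
    · rw [hhigh k h hk.2]
      exact ha k (Finset.mem_Icc.mpr ⟨h, hk.2⟩)
  · intro k hk
    have hk := Finset.mem_Icc.mp hk
    rcases lt_trichotomy k (w jbar) with h | h | h
    · rw [hlam'.2 k h.ne, hlam0 k h.le, zero_mul]
    · rw [h, hmid, mul_zero]
    · rw [hhigh k h hk.2, hlam'.2 k h.ne']
      exact hb k (Finset.mem_Icc.mpr ⟨h, hk.2⟩)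
end
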